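/- arXiv:1905.05023 — 5 statements merged into one kernel-verified Lean document; each statement's English description precedes it below -/
import Mathlib

section
/- Let n be a positive natural number and let X = (X₁, …, X_{2n}) be a centered Gaussian random vector in ℝ^{2n} with covariance matrix Σ. Then the expectation of the product X₁X₂⋯X_{2n} equals the sum, over all partitions of the index set {1, …, 2n} into n unordered pairs (perfect matchings), of the product over the pairs {i, j} of the partition of E[XᵢXⱼ] = Σᵢⱼ. -/
open MeasureTheory ProbabilityTheory Matrix
open scoped Nat

/-- Even moments of a centered real Gaussian. -/
theorem integral_pow_two_mul_gaussianReal (v : NNReal) (n : ℕ) :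
    ∫ x, x ^ (2 * n) ∂(gaussianReal 0 v) = ((2 * n)! : ℝ) / (2 ^ n * n !) * (v : ℝ) ^ n := by
  by_cases hv : v = 0
  · subst hv
    rw [gaussianReal_zero_var, integral_dirac]
    rcases n with _ | n <;> simp
  have hv' : (0 : ℝ) < v := by positivity
  have hfac : ((2 * n)! : ℝ) = ((2 * n - 1)‼ : ℕ) * (2 ^ n * n !) := by
    rcases n with _ | n
    · simp
    · have h := Nat.factorial_eq_mul_doubleFactorial (2 * n + 1)
      have h2 := Nat.doubleFactorial_two_mul (n + 1)
      have e : 2 * (n + 1) - 1 = 2 * n + 1 := by omega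
      rw [e]
      rw [mul_add, mul_one] at h2 ⊢
      rw [h2] at h
      exact_mod_cast h.trans (mul_comm _ _)
  have hint : ∫ x : ℝ, |x| ^ ((2 * n : ℕ) : ℝ) * Real.exp (-(2 * (v : ℝ))⁻¹ * |x| ^ (2 : ℝ))
      = 2 * ((2 * (v : ℝ))⁻¹ ^ (-(((2 * n : ℕ) : ℝ) + 1) / 2) * (1 / 2) *
        Real.Gamma ((((2 * n : ℕ) : ℝ) + 1) / 2)) := by
    rw [integral_comp_abs
      (f := fun x : ℝ => x ^ ((2 * n : ℕ) : ℝ) * Real.exp (-(2 * (v : ℝ))⁻¹ * x ^ (2 : ℝ))),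
      integral_rpow_mul_exp_neg_mul_rpow (by norm_num)
        (lt_of_lt_of_le (by norm_num) (Nat.cast_nonneg _)) (by positivity)]
  have hpt : ∀ x : ℝ, gaussianPDFReal 0 v x • x ^ (2 * n) = (√(2 * Real.pi * v))⁻¹ *
      (|x| ^ ((2 * n : ℕ) : ℝ) * Real.exp (-(2 * (v : ℝ))⁻¹ * |x| ^ (2 : ℝ))) := by
    intro x
    rw [Real.rpow_natCast, Real.rpow_two, sq_abs, pow_mul |x|, sq_abs, ← pow_mul,
      gaussianPDFReal, smul_eq_mul, sub_zero]
    rw [show -x ^ 2 / (2 * (v : ℝ)) = -(2 * (v : ℝ))⁻¹ * x ^ 2 by ring]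
    ring
  rw [integral_gaussianReal_eq_integral_smul hv]
  simp_rw [hpt]
  rw [integral_const_mul, hint,
    show (((2 * n : ℕ) : ℝ) + 1) / 2 = n + 1 / 2 by push_cast; ring, Real.Gamma_nat_add_half,
    show -(((2 * n : ℕ) : ℝ) + 1) / 2 = -(n + 1 / 2) by push_cast; ring,
    Real.inv_rpow (by positivity), Real.rpow_neg (by positivity), inv_inv,
    Real.rpow_add (by positivity), Real.rpow_natCast, ← Real.sqrt_eq_rpow, hfac,
    show 2 * Real.pi * (v : ℝ) = (2 * v) * Real.pi by ring, Real.sqrt_mul (by positivity)]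
  have h1 : √(2 * (v : ℝ)) ≠ 0 := by positivity
  have h2 : √Real.pi ≠ 0 := by positivity
  have h3 : (n ! : ℝ) ≠ 0 := by positivity
  rw [mul_pow]
  field_simp

/-- A product over one representative of each pair of a matching does not depend on the choice of
representatives. -/
theorem prod_transversal_eq {α : Type*} [DecidableEq α] {f : Equiv.Perm α} (hf : ∀ i, f (f i) = i)
    {T T' : Finset α} (hT : ∀ i, f i ∈ T ↔ i ∉ T)
    (hT' : ∀ i, f i ∈ T' ↔ i ∉ T') {g : α → ℝ}
    (hg : ∀ i, g (f i) = g i) : ∏ i ∈ T, g i = ∏ i ∈ T', g i := by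
  refine Finset.prod_nbij' (fun a => if a ∈ T' then a else f a)
    (fun a => if a ∈ T then a else f a) ?_ ?_ ?_ ?_ ?_ <;> intro a ha <;> grind

section Matchings

variable {α : Type*} [Fintype α] [deq : DecidableEq α]

/-- The perfect matchings of `α`, encoded as fixed-point-free involutions. -/
def perfectMatchings (α : Type*) [Fintype α] [DecidableEq α] : Finset (Equiv.Perm α) :=
  Finset.univ.filter fun f => (∀ i, f (f i) = i) ∧ ∀ i, f i ≠ i

theorem mem_perfectMatchings {f : Equiv.Perm α} :
    f ∈ perfectMatchings α ↔ (∀ i, f (f i) = i) ∧ ∀ i, f i ≠ i := by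
  simp [perfectMatchings]

theorem mem_perfectMatchings_iff_cycleType {n : ℕ} (hα : Fintype.card α = 2 * n)
    {f : Equiv.Perm α} :
    f ∈ perfectMatchings α ↔ f.cycleType = Multiset.replicate n 2 := by
  rw [mem_perfectMatchings]
  constructor
  · rintro ⟨h1, h2⟩
    have hf : f ^ 2 = 1 := by ext i; simp [pow_two, h1]
    have hs : f.support = Finset.univ := by ext i; simp [h2]
    have hrep : f.cycleType = Multiset.replicate (Multiset.card f.cycleType) 2 :=
      Multiset.eq_replicate_card.2 fun k hk =>
        le_antisymm (Nat.le_of_dvd two_pos ((Equiv.Perm.dvd_of_mem_cycleType hk).trans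
          (orderOf_dvd_of_pow_eq_one hf))) (Equiv.Perm.two_le_of_mem_cycleType hk)
    have hsum := f.sum_cycleType
    rw [hrep, hs, Finset.card_univ, hα] at hsum
    simp only [Multiset.sum_replicate, smul_eq_mul] at hsum
    rw [hrep, show Multiset.card f.cycleType = n by omega]
  · intro h
    have hsum := f.sum_cycleType
    rw [h, Multiset.sum_replicate, smul_eq_mul] at hsum
    have hs : f.support = Finset.univ := by
      rw [← Finset.card_eq_iff_eq_univ]; omega
    have hf : f ^ 2 = 1 := by
      rw [← orderOf_dvd_iff_pow_eq_one, ← Equiv.Perm.lcm_cycleType, h, Multiset.lcm_dvd]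
      intro b hb
      rw [Multiset.eq_of_mem_replicate hb]
    refine ⟨fun i => ?_, fun i => ?_⟩
    · simpa [pow_two] using DFunLike.congr_fun hf i
    · rw [← Equiv.Perm.mem_support, hs]; exact Finset.mem_univ i

theorem card_perfectMatchings_mul {n : ℕ} (hn : 0 < n) (hα : Fintype.card α = 2 * n) :
    (perfectMatchings α).card * (2 ^ n * n !) = (2 * n)! := by
  have h := Equiv.Perm.card_of_cycleType_mul_eq α (Multiset.replicate n 2)
  have e : perfectMatchings α =
      Finset.univ.filter fun f : Equiv.Perm α => f.cycleType = Multiset.replicate n 2 := by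
    ext f
    simp [mem_perfectMatchings_iff_cycleType hα]
  rw [if_pos ⟨by simp [hα, mul_comm], fun a ha => (Multiset.eq_of_mem_replicate ha).ge⟩, ← e,
    hα, Multiset.toFinset_replicate, if_neg hn.ne'] at h
  simpa [mul_comm n 2] using h

theorem conj_mem_perfectMatchings {f : Equiv.Perm α} (hf : f ∈ perfectMatchings α)
    (σ : Equiv.Perm α) : σ * f * σ⁻¹ ∈ perfectMatchings α := by
  obtain ⟨h1, h2⟩ := mem_perfectMatchings.1 hf
  refine mem_perfectMatchings.2 ⟨by simp [h1], fun i h => h2 (σ⁻¹ i) ?_⟩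
  exact Equiv.Perm.eq_inv_iff_eq.2 h

variable [LinearOrder α]

theorem apply_mem_filter_lt_iff {f : Equiv.Perm α} (hf : f ∈ perfectMatchings α) (i : α) :
    f i ∈ Finset.univ.filter (fun i => i < f i) ↔ i ∉ Finset.univ.filter (fun i => i < f i) := by
  obtain ⟨h1, h2⟩ := mem_perfectMatchings.1 hf
  have := h2 i
  simp only [Finset.mem_filter, Finset.mem_univ, true_and, h1]
  grind

theorem card_filter_lt_apply {n : ℕ} (hα : Fintype.card α = 2 * n) {f : Equiv.Perm α}
    (hf : f ∈ perfectMatchings α) :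
    (Finset.univ.filter (fun i => i < f i)).card = n := by
  have h := apply_mem_filter_lt_iff hf
  generalize Finset.univ.filter (fun i => i < f i) = T at h ⊢
  have hc : T.card = Tᶜ.card := by
    refine Finset.card_nbij' f f ?_ ?_ ?_ ?_ <;> intro a ha <;>
      simp_all [(mem_perfectMatchings.1 hf).1 a]
  have := T.card_add_card_compl
  omega

theorem sum_perfectMatchings_comp (w : α → α → ℝ) (hw : ∀ i j, w i j = w j i)
    (σ : Equiv.Perm α) :
    ∑ f ∈ perfectMatchings α, ∏ i ∈ Finset.univ.filter (fun i => i < f i), w (σ i) (σ (f i)) =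
      ∑ f ∈ perfectMatchings α, ∏ i ∈ Finset.univ.filter (fun i => i < f i), w i (f i) := by
  refine Finset.sum_nbij' (fun f => σ * f * σ⁻¹) (fun f => σ⁻¹ * f * σ)
    (fun f hf => conj_mem_perfectMatchings hf σ)
    (fun f hf => by simpa using conj_mem_perfectMatchings hf σ⁻¹)
    (fun f _ => by group) (fun f _ => by group) fun f hf => ?_
  have hσf := conj_mem_perfectMatchings hf σ
  have h1 := (mem_perfectMatchings.1 hσf).1
  have ht := apply_mem_filter_lt_iff hf
  trans ∏ i ∈ (Finset.univ.filter (fun i => i < f i)).map σ.toEmbedding,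
    w i ((σ * f * σ⁻¹) i)
  · simp
  · refine prod_transversal_eq (f := σ * f * σ⁻¹) h1 (fun i => ?_)
      (apply_mem_filter_lt_iff hσf) fun i => ?_
    · have := ht (σ⁻¹ i)
      simpa [Finset.mem_map_equiv] using this
    · rw [h1, hw]

/-- The product over the pairs `{i, f i}` of a matching `f` of `B (v i) (v (f i))`, as a
multilinear map in `v`. -/
noncomputable def matchingForm {E : Type*} [AddCommGroup E] [Module ℝ E]
    (B : LinearMap.BilinForm ℝ E) {f : Equiv.Perm α} (hf : f ∈ perfectMatchings α) :
    MultilinearMap ℝ (fun _ : α => E) ℝ :=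
  have key : ∀ [DecidableEq α] (v : α → E) (k : α), ∃ L : E →ₗ[ℝ] ℝ, ∀ x : E,
      ∏ i ∈ Finset.univ.filter (fun i => i < f i),
        B (Function.update v k x i) (Function.update v k x (f i)) = L x := by
    intro dec v k
    cases Subsingleton.elim deq dec
    obtain ⟨h1, h2⟩ := mem_perfectMatchings.1 hf
    have h := apply_mem_filter_lt_iff hf
    generalize Finset.univ.filter (fun i => i < f i) = T at h ⊢
    by_cases hk : k ∈ T
    · refine ⟨(∏ i ∈ T.erase k, B (v i) (v (f i))) • B.flip (v (f k)), fun x => ?_⟩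
      rw [← Finset.mul_prod_erase _ _ hk, mul_comm, Function.update_self,
        Function.update_of_ne (h2 k), LinearMap.smul_apply, smul_eq_mul]
      change _ = _ * B x (v (f k))
      congr 1
      refine Finset.prod_congr rfl fun i hi => ?_
      rw [Function.update_of_ne (by grind), Function.update_of_ne (by grind)]
    · have hk' := (h k).2 hk
      refine ⟨(∏ i ∈ T.erase (f k), B (v i) (v (f i))) • B (v (f k)), fun x => ?_⟩
      rw [← Finset.mul_prod_erase _ _ hk', mul_comm, h1, Function.update_self,
        Function.update_of_ne (h2 k), LinearMap.smul_apply, smul_eq_mul]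
      congr 1
      refine Finset.prod_congr rfl fun i hi => ?_
      rw [Function.update_of_ne (by grind), Function.update_of_ne (by grind)]
  { toFun := fun v => ∏ i ∈ Finset.univ.filter (fun i => i < f i), B (v i) (v (f i))
    map_update_add' := fun v k x y => by
      obtain ⟨L, hL⟩ := key v k
      simp only [hL, map_add]
    map_update_smul' := fun v k c x => by
      obtain ⟨L, hL⟩ := key v k
      simp only [hL, map_smul] }

theorem matchingForm_apply {E : Type*} [AddCommGroup E] [Module ℝ E]
    (B : LinearMap.BilinForm ℝ E) {f : Equiv.Perm α} (hf : f ∈ perfectMatchings α) (v : α → E) :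
    matchingForm B hf v =
      ∏ i ∈ Finset.univ.filter (fun i => i < f i), B (v i) (v (f i)) := rfl

end Matchings

/-- Continuous multilinear forms that agree on the diagonal have the same symmetrization. -/
theorem sum_perm_eq_of_diagonal_eq {E F : Type*} [NormedAddCommGroup E] [NormedSpace ℝ E]
    [NormedAddCommGroup F] [NormedSpace ℝ F] {m : ℕ} (f g : E [×m]→L[ℝ] F)
    (h : ∀ x, f (fun _ => x) = g (fun _ => x)) (v : Fin m → E) :
    ∑ σ : Equiv.Perm (Fin m), f (fun i => v (σ i)) =
      ∑ σ : Equiv.Perm (Fin m), g (fun i => v (σ i)) := by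
  rw [← f.iteratedFDeriv_comp_diagonal 0 v, ← g.iteratedFDeriv_comp_diagonal 0 v, funext h]

/-- The sum over all matchings of `matchingForm`, for the bilinear form of a matrix. -/
noncomputable def matchingSumForm {ι : Type*} [Fintype ι] [DecidableEq ι] (S : Matrix ι ι ℝ)
    (m : ℕ) : (ι → ℝ) [×m]→L[ℝ] ℝ where
  toMultilinearMap := ∑ f : perfectMatchings (Fin m), matchingForm (Matrix.toBilin' S) f.2
  cont := by
    change Continuous fun v => (∑ f : perfectMatchings (Fin m),
      matchingForm (Matrix.toBilin' S) f.2) v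
    simp only [_root_.sum_apply, matchingForm_apply, Matrix.toBilin'_apply']
    fun_prop

theorem matchingSumForm_apply {ι : Type*} [Fintype ι] [DecidableEq ι] (S : Matrix ι ι ℝ)
    (m : ℕ) (v : Fin m → ι → ℝ) :
    matchingSumForm S m v = ∑ f ∈ perfectMatchings (Fin m),
      ∏ i ∈ Finset.univ.filter (fun i => i < f i), v i ⬝ᵥ S *ᵥ v (f i) := by
  change (∑ f : perfectMatchings (Fin m), matchingForm (Matrix.toBilin' S) f.2) v = _
  simp only [_root_.sum_apply, matchingForm_apply, Matrix.toBilin'_apply']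
  exact Finset.sum_coe_sort (perfectMatchings (Fin m)) fun f =>
    ∏ i ∈ Finset.univ.filter (fun i => i < f i), v i ⬝ᵥ S *ᵥ v (f i)

/-- The moment form `v ↦ E[∏ₖ ⟨vₖ, X⟩]` of a random vector, expanded in coordinates. -/
noncomputable def momentForm {Ω ι : Type*} [Fintype ι] [MeasurableSpace Ω] (P : Measure Ω)
    (X : ι → Ω → ℝ) (m : ℕ) : (ι → ℝ) [×m]→L[ℝ] ℝ :=
  ∑ c : Fin m → ι, (∫ ω, ∏ k, X (c k) ω ∂P) •
    (ContinuousMultilinearMap.mkPiAlgebra ℝ (Fin m) ℝ).compContinuousLinearMap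
      fun k => ContinuousLinearMap.proj (c k)

theorem momentForm_apply {Ω ι : Type*} [Fintype ι] [DecidableEq ι] [MeasurableSpace Ω]
    {P : Measure Ω} {X : ι → Ω → ℝ} {m : ℕ}
    (hX : ∀ c : Fin m → ι, Integrable (fun ω => ∏ k, X (c k) ω) P) (v : Fin m → ι → ℝ) :
    momentForm P X m v = ∫ ω, ∏ k, ∑ i, v k i * X i ω ∂P := by
  simp only [Finset.prod_univ_sum, Fintype.piFinset_univ, Finset.prod_mul_distrib]
  rw [integral_finsetSum _ fun c _ => (hX c).const_mul _]
  simp only [integral_const_mul]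
  simp [momentForm, mul_comm]

/-- **Isserlis' theorem, even case.** If `X = (X₁, …, X_{2n})` is a centered Gaussian
random vector with covariance matrix `Σ` (joint Gaussianity being expressed by the
Cramér–Wold characterization: every linear combination `∑ aᵢ Xᵢ` is a real Gaussian
with mean `0` and variance `aᵀ Σ a`), then `E[X₁ ⋯ X_{2n}]` equals the sum over all
perfect matchings of `{1, …, 2n}` (encoded as fixed-point-free involutions `f`, the
pairs being `{i, f i}` with `i < f i`) of the product of `Σᵢⱼ` over the pairs. -/
theorem isserlis_even
    {Ω : Type*} [MeasureSpace Ω] (P : Measure Ω) [IsProbabilityMeasure P]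
    (n : ℕ) (hn : 0 < n)
    (X : Fin (2 * n) → Ω → ℝ) (hX : ∀ i, Measurable (X i))
    (S : Matrix (Fin (2 * n)) (Fin (2 * n)) ℝ) (hS : S.PosSemidef)
    (hgauss : ∀ a : Fin (2 * n) → ℝ,
      P.map (fun ω => ∑ i, a i * X i ω) =
        gaussianReal 0 (Real.toNNReal (a ⬝ᵥ S.mulVec a))) :
    ∫ ω, ∏ i, X i ω ∂P =
      ∑ f ∈ Finset.univ.filter
          (fun f : Equiv.Perm (Fin (2 * n)) => (∀ i, f (f i) = i) ∧ ∀ i, f i ≠ i),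
        ∏ i ∈ Finset.univ.filter (fun i => i < f i), S i (f i) := by
  have hsymm : ∀ i j, S i j = S j i := fun i j => by simpa using hS.isHermitian.apply j i
  have hLp : ∀ i (p : NNReal), MemLp (X i) p P := by
    intro i p
    have hmap := hgauss (Pi.single i 1)
    simp only [Pi.single_apply, ite_mul, one_mul, zero_mul, Finset.sum_ite_eq',
      Finset.mem_univ, if_true] at hmap
    have := memLp_id_gaussianReal (μ := 0) (v := Real.toNNReal
      (Pi.single i 1 ⬝ᵥ S.mulVec (Pi.single i 1))) p
    rw [← hmap] at this
    exact (memLp_map_measure_iff aestronglyMeasurable_id (hX i).aemeasurable).1 this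
  have hint : ∀ c : Fin (2 * n) → Fin (2 * n), Integrable (fun ω => ∏ k, X (c k) ω) P := by
    intro c
    have := MemLp.prod' (s := Finset.univ) (f := fun k => X (c k)) (μ := P)
      (p := fun _ => ((2 * n : ℕ) : NNReal)) fun k _ => hLp (c k) _
    rw [← memLp_one_iff_integrable]
    convert this
    simp only [Finset.sum_const, Finset.card_univ, Fintype.card_fin, nsmul_eq_mul]
    rw [ENNReal.coe_natCast, ENNReal.mul_inv_cancel (Nat.cast_ne_zero.2 (by omega))
      (ENNReal.natCast_ne_top _), inv_one]
  have hdiag : ∀ a : Fin (2 * n) → ℝ,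
      momentForm P X (2 * n) (fun _ => a) = matchingSumForm S (2 * n) (fun _ => a) := by
    intro a
    have hnn : 0 ≤ a ⬝ᵥ S *ᵥ a := by simpa using hS.dotProduct_mulVec_nonneg a
    have hcard := card_perfectMatchings_mul hn (α := Fin (2 * n)) (by simp)
    have hsum : ∫ ω, (∑ i, a i * X i ω) ^ (2 * n) ∂P =
        ∫ x, x ^ (2 * n) ∂(P.map (fun ω => ∑ i, a i * X i ω)) :=
      (integral_map (by fun_prop) (continuous_pow (2 * n)).aestronglyMeasurable).symm
    rw [momentForm_apply hint, matchingSumForm_apply]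
    simp only [Finset.prod_const, Finset.card_univ, Fintype.card_fin]
    rw [hsum, hgauss, integral_pow_two_mul_gaussianReal, Real.coe_toNNReal _ hnn,
      Finset.sum_congr rfl fun f hf => congrArg ((a ⬝ᵥ S *ᵥ a) ^ ·)
        (card_filter_lt_apply (Fintype.card_fin _) hf),
      Finset.sum_const, nsmul_eq_mul, ← hcard]
    congr 1
    push_cast
    field_simp
  have hpol := sum_perm_eq_of_diagonal_eq _ _ hdiag fun i => Pi.single i 1
  have hmoment : ∀ σ : Equiv.Perm (Fin (2 * n)),
      momentForm P X (2 * n) (fun i => Pi.single (σ i) 1) = ∫ ω, ∏ i, X i ω ∂P := by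
    intro σ
    rw [momentForm_apply hint]
    simp only [Pi.single_apply, ite_mul, one_mul, zero_mul, Finset.sum_ite_eq', Finset.mem_univ,
      if_true]
    exact integral_congr_ae (.of_forall fun ω => Equiv.prod_comp σ fun i => X i ω)
  have hmatch : ∀ σ : Equiv.Perm (Fin (2 * n)),
      matchingSumForm S (2 * n) (fun i => Pi.single (σ i) 1) =
        ∑ f ∈ perfectMatchings (Fin (2 * n)),
          ∏ i ∈ Finset.univ.filter (fun i => i < f i), S i (f i) := by
    intro σ
    rw [matchingSumForm_apply, ← sum_perfectMatchings_comp S hsymm σ]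
    simp
  simp only [hmoment, hmatch, Finset.sum_const, nsmul_eq_mul] at hpol
  convert mul_left_cancel₀ (Nat.cast_ne_zero.2 Finset.univ_nonempty.card_ne_zero) hpol
  ext f
  simp [mem_perfectMatchings]
end

section
/- Let ρ ∈ (−1, 1) and let (x, y) be a bivariate Gaussian random vector with mean 0, Var(x) = Var(y) = 1, and E[xy] = ρ. Then the fourth central moment of the product xy satisfies E[(xy − ρ)⁴] = 3(3 + 14ρ² + 3ρ⁴). -/
open MeasureTheory Real

/-- The bivariate Gaussian measure on `ℝ × ℝ` with mean `0` and covariance matrix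
`[[1, ρ], [ρ, 1]]`, given by its Lebesgue density. -/
noncomputable def stdBivariateGaussian (ρ : ℝ) : Measure (ℝ × ℝ) :=
  volume.withDensity fun p =>
    ENNReal.ofReal ((2 * π * Real.sqrt (1 - ρ ^ 2))⁻¹ *
      Real.exp (-(p.1 ^ 2 - 2 * ρ * p.1 * p.2 + p.2 ^ 2) / (2 * (1 - ρ ^ 2))))

/-- The bivariate Gaussian with correlation `ρ` is the law of `(u, ρ u + √(1 - ρ²) v)` for
independent standard Gaussians `u`, `v`. -/
theorem stdBivariateGaussian_eq_map (ρ : ℝ) (h1 : -1 < ρ) (h2 : ρ < 1) :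
    stdBivariateGaussian ρ =
      ((ProbabilityTheory.gaussianReal 0 1).prod (ProbabilityTheory.gaussianReal 0 1)).map
        fun p => (p.1, ρ * p.1 + Real.sqrt (1 - ρ ^ 2) * p.2) := by
  have hs : 0 < 1 - ρ ^ 2 := by nlinarith
  obtain ⟨v, hv⟩ : ∃ v : NNReal, (v : ℝ) = 1 - ρ ^ 2 := ⟨⟨_, hs.le⟩, rfl⟩
  have hdens (x y : ℝ) : ENNReal.ofReal ((2 * π * Real.sqrt (1 - ρ ^ 2))⁻¹ *
      Real.exp (-(x ^ 2 - 2 * ρ * x * y + y ^ 2) / (2 * (1 - ρ ^ 2)))) =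
      ProbabilityTheory.gaussianPDF 0 1 x *
        ProbabilityTheory.gaussianPDF (ρ * x) v y := by
    rw [ProbabilityTheory.gaussianPDF_def, ProbabilityTheory.gaussianPDF_def,
      ← ENNReal.ofReal_mul (ProbabilityTheory.gaussianPDFReal_nonneg _ _ _)]
    congr 1
    simp only [ProbabilityTheory.gaussianPDFReal, NNReal.coe_one, hv]
    rw [mul_mul_mul_comm, ← Real.exp_add, ← mul_inv, Real.sqrt_mul (by positivity) (1 - ρ ^ 2),
      mul_one, ← mul_assoc, Real.mul_self_sqrt (by positivity)]
    congr 2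
    field_simp
    ring
  have hcond (x : ℝ) : ProbabilityTheory.gaussianReal (ρ * x) v =
      (ProbabilityTheory.gaussianReal 0 1).map fun z => ρ * x + Real.sqrt (1 - ρ ^ 2) * z := by
    have : (fun z => ρ * x + Real.sqrt (1 - ρ ^ 2) * z) =
        (fun z => ρ * x + z) ∘ fun z => Real.sqrt (1 - ρ ^ 2) * z := rfl
    rw [this, ← Measure.map_map (by fun_prop) (by fun_prop),
      ProbabilityTheory.gaussianReal_map_const_mul, ProbabilityTheory.gaussianReal_map_const_add]
    congr 1
    · simp
    · ext
      simp [Real.sq_sqrt hs.le, hv]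
  refine Measure.ext_of_lintegral _ fun f hf => ?_
  rw [stdBivariateGaussian, lintegral_withDensity_eq_lintegral_mul _ (by fun_prop) hf,
    lintegral_map hf (by fun_prop), lintegral_prod _ (by fun_prop),
    Measure.volume_eq_prod, lintegral_prod _ (by fun_prop)]
  conv_rhs => rw [ProbabilityTheory.gaussianReal_of_var_ne_zero 0 one_ne_zero]
  rw [lintegral_withDensity_eq_lintegral_mul₀ (by fun_prop)]
  · refine lintegral_congr fun x => ?_
    simp only [Pi.mul_apply, hdens]
    simp only [mul_assoc]
    rw [lintegral_const_mul _ (by fun_prop)]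
    congr 1
    have hne : v ≠ 0 := by
      rintro rfl
      exact hs.ne hv
    have := lintegral_map (μ := ProbabilityTheory.gaussianReal 0 1)
      (g := fun z => ρ * x + Real.sqrt (1 - ρ ^ 2) * z) (f := fun y => f (x, y))
      (by fun_prop) (by fun_prop)
    rw [← ProbabilityTheory.gaussianReal_of_var_ne_zero 0 one_ne_zero, ← this, ← hcond,
      ProbabilityTheory.gaussianReal_of_var_ne_zero _ hne,
      lintegral_withDensity_eq_lintegral_mul _ (by fun_prop)
        (g := fun y => f (x, y)) (by fun_prop)]
    rfl
  · rw [← ProbabilityTheory.gaussianReal_of_var_ne_zero 0 one_ne_zero]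
    exact (Measurable.lintegral_prod_right' (f := fun p : ℝ × ℝ =>
      f (p.1, ρ * p.1 + Real.sqrt (1 - ρ ^ 2) * p.2)) (by fun_prop)).aemeasurable

theorem integrable_pow_gaussianReal (μ : ℝ) (v : NNReal) (n : ℕ) :
    Integrable (fun x : ℝ => x ^ n) (ProbabilityTheory.gaussianReal μ v) :=
  ProbabilityTheory.integrable_pow_of_mem_interior_integrableExpSet (X := fun x => x)
    (by simp) n

/-- The recursion for the moments of the standard Gaussian. -/
theorem integral_pow_add_two_gaussianReal (n : ℕ) :
    ∫ x, x ^ (n + 2) ∂(ProbabilityTheory.gaussianReal 0 1) =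
      (n + 1) * ∫ x, x ^ n ∂(ProbabilityTheory.gaussianReal 0 1) := by
  have hint (k : ℕ) :
      Integrable (fun x => ProbabilityTheory.gaussianPDFReal 0 1 x * x ^ k) := by
    have h := integrable_pow_gaussianReal 0 1 k
    rw [ProbabilityTheory.gaussianReal_of_var_ne_zero 0 one_ne_zero,
      integrable_withDensity_iff_integrable_smul' (by fun_prop)
        (ae_of_all _ fun _ => ProbabilityTheory.gaussianPDF_lt_top)] at h
    simpa [ProbabilityTheory.toReal_gaussianPDF] using h
  have hderiv (x : ℝ) : HasDerivAt
      (fun x => ProbabilityTheory.gaussianPDFReal 0 1 x * x ^ (n + 1))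
      ((n + 1) * (ProbabilityTheory.gaussianPDFReal 0 1 x * x ^ n) -
        ProbabilityTheory.gaussianPDFReal 0 1 x * x ^ (n + 2)) x := by
    have h : HasDerivAt (ProbabilityTheory.gaussianPDFReal 0 1)
        (-x * ProbabilityTheory.gaussianPDFReal 0 1 x) x := by
      have hq : HasDerivAt (fun x : ℝ => -(x - 0) ^ 2 / (2 * ((1 : NNReal) : ℝ))) (-x) x := by
        convert! ((((hasDerivAt_id x).sub_const 0).pow 2).neg).div_const
          (2 * ((1 : NNReal) : ℝ)) using 1
        simp
        ring
      convert! hq.exp.const_mul (√(2 * π * ((1 : NNReal) : ℝ)))⁻¹ using 1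
      simp only [ProbabilityTheory.gaussianPDFReal]
      ring
    convert! h.mul (hasDerivAt_pow (n + 1) x) using 1
    push_cast
    ring
  have h0 := integral_eq_zero_of_hasDerivAt_of_integrable hderiv
    (((hint n).const_mul _).sub (hint (n + 2))) (hint (n + 1))
  rw [integral_sub ((hint n).const_mul _) (hint (n + 2)), integral_const_mul] at h0
  simp only [ProbabilityTheory.integral_gaussianReal_eq_integral_smul
    (one_ne_zero : (1 : NNReal) ≠ 0), smul_eq_mul]
  linarith

/-- **Haldane.** For `(x, y)` standard bivariate Gaussian with correlation `ρ ∈ (−1, 1)`,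
the fourth central moment of `xy` is `E[(xy − ρ)⁴] = 3(3 + 14ρ² + 3ρ⁴)`. -/
theorem fourthCentralMoment_mul_stdBivariateGaussian (ρ : ℝ) (h1 : -1 < ρ) (h2 : ρ < 1) :
    ∫ p : ℝ × ℝ, (p.1 * p.2 - ρ) ^ 4 ∂(stdBivariateGaussian ρ) = 3 * (3 + 14 * ρ ^ 2 + 3 * ρ ^ 4) := by
  set γ := ProbabilityTheory.gaussianReal 0 1 with hγ
  have m0 : ∫ x, x ^ 0 ∂γ = 1 := by simp
  have m1 : ∫ x, x ^ 1 ∂γ = 0 := by simp [hγ]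
  have m2 : ∫ x, x ^ 2 ∂γ = 1 := by
    rw [integral_pow_add_two_gaussianReal 0, m0]; norm_num
  have m3 : ∫ x, x ^ 3 ∂γ = 0 := by
    rw [integral_pow_add_two_gaussianReal 1, m1]; norm_num
  have m4 : ∫ x, x ^ 4 ∂γ = 3 := by
    rw [integral_pow_add_two_gaussianReal 2, m2]; norm_num
  have m6 : ∫ x, x ^ 6 ∂γ = 15 := by
    rw [integral_pow_add_two_gaussianReal 4, m4]; norm_num
  have m8 : ∫ x, x ^ 8 ∂γ = 105 := by
    rw [integral_pow_add_two_gaussianReal 6, m6]; norm_num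
  have hmono (c : ℝ) (i j : ℕ) :
      Integrable (fun p : ℝ × ℝ => c * (p.1 ^ i * p.2 ^ j)) (γ.prod γ) :=
    ((integrable_pow_gaussianReal 0 1 i).mul_prod (integrable_pow_gaussianReal 0 1 j)).const_mul c
  have hval (c : ℝ) (i j : ℕ) : ∫ p : ℝ × ℝ, c * (p.1 ^ i * p.2 ^ j) ∂(γ.prod γ) =
      c * ((∫ x, x ^ i ∂γ) * ∫ x, x ^ j ∂γ) := by
    rw [integral_const_mul, integral_prod_mul (fun x : ℝ => x ^ i) fun x : ℝ => x ^ j]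
  set s := Real.sqrt (1 - ρ ^ 2) with hs
  have hs2 : s ^ 2 = 1 - ρ ^ 2 := Real.sq_sqrt (by nlinarith)
  let t : Fin 15 → ℝ × ℕ × ℕ := ![(ρ ^ 4, 8, 0), (-4 * ρ ^ 4, 6, 0), (6 * ρ ^ 4, 4, 0),
    (-4 * ρ ^ 4, 2, 0), (ρ ^ 4, 0, 0), (4 * ρ ^ 3 * s, 7, 1), (-12 * ρ ^ 3 * s, 5, 1),
    (12 * ρ ^ 3 * s, 3, 1), (-4 * ρ ^ 3 * s, 1, 1), (6 * ρ ^ 2 * s ^ 2, 6, 2),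
    (-12 * ρ ^ 2 * s ^ 2, 4, 2), (6 * ρ ^ 2 * s ^ 2, 2, 2), (4 * ρ * s ^ 3, 5, 3),
    (-4 * ρ * s ^ 3, 3, 3), (s ^ 4, 4, 4)]
  have hexp (p : ℝ × ℝ) : (p.1 * (ρ * p.1 + s * p.2) - ρ) ^ 4 =
      ∑ k, (t k).1 * (p.1 ^ (t k).2.1 * p.2 ^ (t k).2.2) := by
    simp [t, Fin.sum_univ_succ]
    ring
  rw [stdBivariateGaussian_eq_map ρ h1 h2, integral_map (by fun_prop) (by fun_prop)]
  simp only [← hs, ← hγ, hexp]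
  rw [integral_finsetSum _ fun k _ => hmono _ _ _]
  simp only [hval]
  simp only [t, Fin.sum_univ_succ, Fin.sum_univ_zero, Matrix.cons_val_zero, Matrix.cons_val_succ,
    m0, m1, m2, m3, m4, m6, m8]
  have hs4 : s ^ 4 = (1 - ρ ^ 2) ^ 2 := by rw [← hs2]; ring
  rw [hs4, hs2]
  ring
end

section
/- Let σ_X > 0, σ_R > 0, ρ ∈ (−1, 1), and let (X, R) be a bivariate Gaussian random vector with mean 0, Var(X) = σ_X², Var(R) = σ_R², and correlation ρ. Let S = X·R. Then the skewness of S satisfies γ₃(S) = E[(S − E S)³]/(Var S)^{3/2} = 2ρ(3 + ρ²)/(1 + ρ²)^{3/2}. -/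
open MeasureTheory Real

/-- The bivariate Gaussian measure on `ℝ × ℝ` with mean `0` and covariance matrix
`[[σX², ρ σX σR], [ρ σX σR, σR²]]`, given by its Lebesgue density.  The first
coordinate is the signal `X`, the second the return `R`. -/
noncomputable def bivariateGaussian (σX σR ρ : ℝ) : Measure (ℝ × ℝ) :=
  volume.withDensity fun p =>
    ENNReal.ofReal ((2 * π * σX * σR * Real.sqrt (1 - ρ ^ 2))⁻¹ *
      Real.exp (-((p.1 / σX) ^ 2 - 2 * ρ * (p.1 / σX) * (p.2 / σR) + (p.2 / σR) ^ 2) /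
        (2 * (1 - ρ ^ 2))))

open ProbabilityTheory

lemma integrable_pow_gaussianReal_zero_one (n : ℕ) :
    Integrable (fun x : ℝ ↦ x ^ n) (gaussianReal 0 1) := by
  have h : MemLp id n (gaussianReal 0 1) := memLp_id_gaussianReal' n (by simp)
  refine (h.integrable_norm_pow').mono' (by fun_prop) (ae_of_all _ fun x ↦ ?_)
  simp

lemma hasDerivAt_gaussianPDFReal_zero_one (x : ℝ) :
    HasDerivAt (gaussianPDFReal 0 1) (-x * gaussianPDFReal 0 1 x) x := by
  have h : HasDerivAt (fun y : ℝ ↦ -(y - 0) ^ 2 / (2 * ((1 : NNReal) : ℝ))) (-x) x := by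
    have := ((((hasDerivAt_id x).sub_const 0).pow 2).neg).div_const (2 * ((1 : NNReal) : ℝ))
    convert! this using 1
    simp
    ring
  rw [gaussianPDFReal_def]
  convert! h.exp.const_mul (√(2 * π * ((1 : NNReal) : ℝ)))⁻¹ using 1
  ring

lemma integrable_pow_mul_gaussianPDFReal_zero_one (n : ℕ) :
    Integrable (fun x : ℝ ↦ x ^ n * gaussianPDFReal 0 1 x) := by
  have h := integrable_pow_gaussianReal_zero_one n
  rw [gaussianReal_of_var_ne_zero 0 one_ne_zero,
    integrable_withDensity_iff_integrable_smul' (measurable_gaussianPDF 0 1)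
      (ae_of_all _ fun _ ↦ gaussianPDF_lt_top)] at h
  simpa [toReal_gaussianPDF, mul_comm] using h

/-- Stein's recursion for the moments of the standard Gaussian measure. -/
lemma integral_pow_add_two_gaussianReal_zero_one (n : ℕ) :
    ∫ x, x ^ (n + 2) ∂gaussianReal 0 1 = (n + 1) * ∫ x, x ^ n ∂gaussianReal 0 1 := by
  have h := integral_mul_deriv_eq_deriv_mul_of_integrable
    (u := fun x : ℝ ↦ x ^ (n + 1)) (u' := fun x ↦ ((n + 1 : ℕ) : ℝ) * x ^ n)
    (v := gaussianPDFReal 0 1) (v' := fun x ↦ -x * gaussianPDFReal 0 1 x)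
    (fun x _ ↦ by simpa using hasDerivAt_pow (n + 1) x)
    (fun x _ ↦ hasDerivAt_gaussianPDFReal_zero_one x)
    ((integrable_pow_mul_gaussianPDFReal_zero_one (n + 2)).neg.congr
      (ae_of_all _ fun x ↦ by simp; ring))
    (((integrable_pow_mul_gaussianPDFReal_zero_one n).const_mul ((n + 1 : ℕ) : ℝ)).congr
      (ae_of_all _ fun x ↦ by simp; ring))
    (integrable_pow_mul_gaussianPDFReal_zero_one (n + 1))
  rw [integral_gaussianReal_eq_integral_smul one_ne_zero,
    integral_gaussianReal_eq_integral_smul one_ne_zero, ← integral_const_mul, ← neg_inj,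
    ← integral_neg]
  convert! h using 1
  · congr 1 with x
    simp only [smul_eq_mul]
    ring
  · congr 2 with x
    simp only [smul_eq_mul]
    push_cast
    ring

/-- The bivariate Gaussian measure is the law of `(σX U, σR (ρ U + √(1 - ρ²) V))` for independent
standard Gaussian `U` and `V`. -/
lemma integral_bivariateGaussian {σX σR ρ : ℝ} (hσX : 0 < σX) (hσR : 0 < σR)
    (h1 : -1 < ρ) (h2 : ρ < 1) {f : ℝ × ℝ → ℝ} (hf : Measurable f) :
    ∫ p, f p ∂bivariateGaussian σX σR ρ =
      ∫ z, f (σX * z.1, σR * (ρ * z.1 + √(1 - ρ ^ 2) * z.2))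
        ∂(gaussianReal 0 1).prod (gaussianReal 0 1) := by
  have hρ : 0 < 1 - ρ ^ 2 := by nlinarith
  set c := √(1 - ρ ^ 2)
  have hc0 : 0 < c := Real.sqrt_pos.2 hρ
  have hc2 : c ^ 2 = 1 - ρ ^ 2 := Real.sq_sqrt hρ.le
  let L : ℝ × ℝ →ₗ[ℝ] ℝ × ℝ :=
    Matrix.toLin (Module.Basis.finTwoProd ℝ) (Module.Basis.finTwoProd ℝ) !![σX, 0; σR * ρ, σR * c]
  have hL : ∀ z, L z = (σX * z.1, σR * (ρ * z.1 + c * z.2)) := fun z ↦ by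
    simp only [L, Matrix.toLin_finTwoProd_apply]
    ext <;> simp
    ring
  have hdet : LinearMap.det L = σX * (σR * c) := by
    simp [L, LinearMap.det_toLin, Matrix.det_fin_two]
  have hpos : 0 < σX * (σR * c) := by positivity
  have hLm : Measurable L := by
    have : (L : ℝ × ℝ → ℝ × ℝ) = fun z ↦ (σX * z.1, σR * (ρ * z.1 + c * z.2)) := funext hL
    rw [this]; fun_prop
  have hmap := Measure.map_linearMap_addHaar_eq_smul_addHaar (volume : Measure (ℝ × ℝ))
    (f := L) (by rw [hdet]; exact hpos.ne')
  have hφ : Measurable fun z : ℝ × ℝ ↦ gaussianPDF 0 1 z.1 * gaussianPDF 0 1 z.2 :=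
    ((measurable_gaussianPDF 0 1).comp measurable_fst).mul
      ((measurable_gaussianPDF 0 1).comp measurable_snd)
  rw [bivariateGaussian, integral_withDensity_eq_integral_toReal_smul (by fun_prop)
      (ae_of_all _ fun _ ↦ ENNReal.ofReal_lt_top),
    gaussianReal_of_var_ne_zero 0 one_ne_zero,
    prod_withDensity (measurable_gaussianPDF 0 1) (measurable_gaussianPDF 0 1),
    integral_withDensity_eq_integral_toReal_smul hφ
      (ae_of_all _ fun _ ↦ ENNReal.mul_lt_top gaussianPDF_lt_top gaussianPDF_lt_top),
    ← Measure.volume_eq_prod]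
  rw [hdet, abs_of_pos (inv_pos.2 hpos)] at hmap
  set g : ℝ × ℝ → ℝ := fun p ↦ (ENNReal.ofReal ((2 * π * σX * σR * c)⁻¹ *
      Real.exp (-((p.1 / σX) ^ 2 - 2 * ρ * (p.1 / σX) * (p.2 / σR) + (p.2 / σR) ^ 2) /
        (2 * (1 - ρ ^ 2))))).toReal • f p with hg
  have hgm : Measurable g := by fun_prop
  have key : ∫ z, g (L z) = (σX * (σR * c))⁻¹ * ∫ p, g p := by
    rw [← integral_map hLm.aemeasurable hgm.aestronglyMeasurable, hmap, integral_smul_measure,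
      ENNReal.toReal_ofReal (inv_pos.2 hpos).le, smul_eq_mul]
  have key' : ∫ p, g p = ∫ z, (σX * (σR * c)) * g (L z) := by
    rw [integral_const_mul, key, mul_inv_cancel_left₀ hpos.ne']
  rw [key']
  congr 1 with z
  have hexp : -((σX * z.1 / σX) ^ 2 - 2 * ρ * (σX * z.1 / σX) *
        (σR * (ρ * z.1 + c * z.2) / σR) + (σR * (ρ * z.1 + c * z.2) / σR) ^ 2) /
        (2 * (1 - ρ ^ 2)) = -z.1 ^ 2 / 2 + -z.2 ^ 2 / 2 := by
    rw [mul_div_cancel_left₀ _ hσX.ne', mul_div_cancel_left₀ _ hσR.ne', ← hc2]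
    field_simp
    linear_combination z.1 ^ 2 * hc2
  have hs : (√(2 * π)) ^ 2 = 2 * π := Real.sq_sqrt (by positivity)
  simp only [hg, hL, ENNReal.toReal_mul, toReal_gaussianPDF, gaussianPDFReal, smul_eq_mul]
  rw [ENNReal.toReal_ofReal (by positivity), hexp, Real.exp_add]
  simp only [NNReal.coe_one, mul_one, sub_zero]
  have : (2 * π * σX * σR * c)⁻¹ = (√(2 * π))⁻¹ * (√(2 * π))⁻¹ * (σX * (σR * c))⁻¹ := by
    rw [← mul_inv, ← mul_inv, ← sq, hs]
    congr 1
    ring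
  rw [this]
  field_simp

lemma integrable_pow_mul_pow_gaussianReal_prod (i j : ℕ) :
    Integrable (fun z : ℝ × ℝ ↦ z.1 ^ i * z.2 ^ j)
      ((gaussianReal 0 1).prod (gaussianReal 0 1)) :=
  (integrable_pow_gaussianReal_zero_one i).mul_prod (integrable_pow_gaussianReal_zero_one j)

lemma mul_linear_pow_eq_sum (a b : ℝ) (k : ℕ) (z : ℝ × ℝ) :
    (z.1 * (a * z.1 + b * z.2)) ^ k = ∑ m ∈ Finset.range (k + 1),
      (a ^ m * b ^ (k - m) * k.choose m) * (z.1 ^ (k + m) * z.2 ^ (k - m)) := by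
  rw [mul_pow, add_pow, Finset.mul_sum]
  refine Finset.sum_congr rfl fun m _ ↦ ?_
  ring

lemma integrable_mul_linear_pow (a b : ℝ) (k : ℕ) :
    Integrable (fun z : ℝ × ℝ ↦ (z.1 * (a * z.1 + b * z.2)) ^ k)
      ((gaussianReal 0 1).prod (gaussianReal 0 1)) := by
  simp_rw [mul_linear_pow_eq_sum]
  exact integrable_finsetSum _ fun m _ ↦
    (integrable_pow_mul_pow_gaussianReal_prod _ _).const_mul _

lemma integral_mul_linear_pow (a b : ℝ) (k : ℕ) :
    ∫ z : ℝ × ℝ, (z.1 * (a * z.1 + b * z.2)) ^ k ∂(gaussianReal 0 1).prod (gaussianReal 0 1) =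
      ∑ m ∈ Finset.range (k + 1), (a ^ m * b ^ (k - m) * k.choose m) *
        ((∫ x, x ^ (k + m) ∂gaussianReal 0 1) * ∫ x, x ^ (k - m) ∂gaussianReal 0 1) := by
  simp_rw [mul_linear_pow_eq_sum]
  rw [integral_finsetSum _ fun m _ ↦ (integrable_pow_mul_pow_gaussianReal_prod _ _).const_mul _]
  refine Finset.sum_congr rfl fun m _ ↦ ?_
  rw [integral_const_mul, integral_prod_mul (fun x : ℝ ↦ x ^ (k + m)) fun x : ℝ ↦ x ^ (k - m)]

/-- **Skewness of a one-period linear strategy.** For `(X, R)` centered bivariate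
Gaussian with standard deviations `σX, σR > 0` and correlation `ρ ∈ (−1, 1)`, and
`S = X·R`, the skewness satisfies
`γ₃(S) = E[(S − E S)³]/(Var S)^{3/2} = 2ρ(3 + ρ²)/(1 + ρ²)^{3/2}`. -/
theorem skewness_linear_strategy (σX σR ρ : ℝ) (hσX : 0 < σX) (hσR : 0 < σR)
    (h1 : -1 < ρ) (h2 : ρ < 1) :
    (∫ p : ℝ × ℝ,
        (p.1 * p.2 - ∫ q : ℝ × ℝ, q.1 * q.2 ∂(bivariateGaussian σX σR ρ)) ^ 3
          ∂(bivariateGaussian σX σR ρ)) /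
      (∫ p : ℝ × ℝ,
        (p.1 * p.2 - ∫ q : ℝ × ℝ, q.1 * q.2 ∂(bivariateGaussian σX σR ρ)) ^ 2
          ∂(bivariateGaussian σX σR ρ)) ^ ((3 : ℝ) / 2) =
    2 * ρ * (3 + ρ ^ 2) / (1 + ρ ^ 2) ^ ((3 : ℝ) / 2) := by
  have hρ : 0 < 1 - ρ ^ 2 := by nlinarith
  have hc2 : √(1 - ρ ^ 2) ^ 2 = 1 - ρ ^ 2 := Real.sq_sqrt hρ.le
  have M0 : ∫ x, x ^ 0 ∂gaussianReal 0 1 = (1 : ℝ) := by simp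
  have M1 : ∫ x, x ^ 1 ∂gaussianReal 0 1 = (0 : ℝ) := by simp [integral_id_gaussianReal]
  have M2 : ∫ x, x ^ 2 ∂gaussianReal 0 1 = (1 : ℝ) := by
    rw [integral_pow_add_two_gaussianReal_zero_one 0, M0]; norm_num
  have M3 : ∫ x, x ^ 3 ∂gaussianReal 0 1 = (0 : ℝ) := by
    rw [integral_pow_add_two_gaussianReal_zero_one 1, M1, mul_zero]
  have M4 : ∫ x, x ^ 4 ∂gaussianReal 0 1 = (3 : ℝ) := by
    rw [integral_pow_add_two_gaussianReal_zero_one 2, M2]; norm_num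
  have M5 : ∫ x, x ^ 5 ∂gaussianReal 0 1 = (0 : ℝ) := by
    rw [integral_pow_add_two_gaussianReal_zero_one 3, M3, mul_zero]
  have M6 : ∫ x, x ^ 6 ∂gaussianReal 0 1 = (15 : ℝ) := by
    rw [integral_pow_add_two_gaussianReal_zero_one 4, M4]; norm_num
  set γ := (gaussianReal 0 1).prod (gaussianReal 0 1)
  set c := √(1 - ρ ^ 2)
  have I (k : ℕ) : Integrable (fun z : ℝ × ℝ ↦ (z.1 * (ρ * z.1 + c * z.2)) ^ k) γ :=
    integrable_mul_linear_pow ρ c k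
  have I2 : Integrable (fun z : ℝ × ℝ ↦ (z.1 * (ρ * z.1 + c * z.2)) ^ 2
      - 2 * ρ * (z.1 * (ρ * z.1 + c * z.2)) ^ 1) γ := (I 2).sub ((I 1).const_mul _)
  have I3 : Integrable (fun z : ℝ × ℝ ↦ (z.1 * (ρ * z.1 + c * z.2)) ^ 3
      - 3 * ρ * (z.1 * (ρ * z.1 + c * z.2)) ^ 2) γ := (I 3).sub ((I 2).const_mul _)
  have I3' : Integrable (fun z : ℝ × ℝ ↦ (z.1 * (ρ * z.1 + c * z.2)) ^ 3
      - 3 * ρ * (z.1 * (ρ * z.1 + c * z.2)) ^ 2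
      + 3 * ρ ^ 2 * (z.1 * (ρ * z.1 + c * z.2)) ^ 1) γ := I3.add ((I 1).const_mul _)
  have E1 : ∫ z : ℝ × ℝ, (z.1 * (ρ * z.1 + c * z.2)) ^ 1 ∂γ = ρ := by
    rw [integral_mul_linear_pow]
    simp only [Finset.sum_range_succ, Finset.sum_range_zero, Nat.reduceAdd, Nat.reduceSub,
      M0, M1, M2]
    simp
  have E2 : ∫ z : ℝ × ℝ, (z.1 * (ρ * z.1 + c * z.2)) ^ 2 ∂γ = 1 + 2 * ρ ^ 2 := by
    rw [integral_mul_linear_pow]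
    simp only [Finset.sum_range_succ, Finset.sum_range_zero, Nat.reduceAdd, Nat.reduceSub,
      M0, M1, M2, M3, M4]
    norm_num [Nat.choose]
    linear_combination hc2
  have E3 : ∫ z : ℝ × ℝ, (z.1 * (ρ * z.1 + c * z.2)) ^ 3 ∂γ = 9 * ρ + 6 * ρ ^ 3 := by
    rw [integral_mul_linear_pow]
    simp only [Finset.sum_range_succ, Finset.sum_range_zero, Nat.reduceAdd, Nat.reduceSub,
      M0, M1, M2, M3, M4, M5, M6]
    norm_num [Nat.choose]
    linear_combination 9 * ρ * hc2
  have C1 : ∫ p : ℝ × ℝ, p.1 * p.2 ∂bivariateGaussian σX σR ρ = σX * σR * ρ := by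
    rw [integral_bivariateGaussian hσX hσR h1 h2 (by fun_prop)]
    calc _ = ∫ z : ℝ × ℝ, σX * σR * (z.1 * (ρ * z.1 + c * z.2)) ^ 1 ∂γ := by
          congr 1 with z
          ring
      _ = _ := by rw [integral_const_mul, E1]
  have C2 : ∫ p : ℝ × ℝ, (p.1 * p.2 - σX * σR * ρ) ^ 2 ∂bivariateGaussian σX σR ρ =
      (σX * σR) ^ 2 * (1 + ρ ^ 2) := by
    rw [integral_bivariateGaussian hσX hσR h1 h2 (by fun_prop)]
    calc _ = ∫ z : ℝ × ℝ, (σX * σR) ^ 2 * ((z.1 * (ρ * z.1 + c * z.2)) ^ 2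
          - 2 * ρ * (z.1 * (ρ * z.1 + c * z.2)) ^ 1 + ρ ^ 2) ∂γ := by
          congr 1 with z
          ring
      _ = _ := by
          rw [integral_const_mul, integral_add I2 (integrable_const _), integral_sub (I 2) ((I 1).const_mul _), integral_const_mul,
            E1, E2, integral_const, probReal_univ, one_smul]
          ring
  have C3 : ∫ p : ℝ × ℝ, (p.1 * p.2 - σX * σR * ρ) ^ 3 ∂bivariateGaussian σX σR ρ =
      (σX * σR) ^ 3 * (2 * ρ * (3 + ρ ^ 2)) := by
    rw [integral_bivariateGaussian hσX hσR h1 h2 (by fun_prop)]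
    calc _ = ∫ z : ℝ × ℝ, (σX * σR) ^ 3 * ((z.1 * (ρ * z.1 + c * z.2)) ^ 3
          - 3 * ρ * (z.1 * (ρ * z.1 + c * z.2)) ^ 2
          + 3 * ρ ^ 2 * (z.1 * (ρ * z.1 + c * z.2)) ^ 1 - ρ ^ 3) ∂γ := by
          congr 1 with z
          ring
      _ = _ := by
          rw [integral_const_mul, integral_sub I3' (integrable_const _),
            integral_add I3 ((I 1).const_mul _), integral_sub (I 3) ((I 2).const_mul _),
            integral_const_mul, integral_const_mul, E1, E2, E3, integral_const, probReal_univ,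
            one_smul]
          ring
  have hσ : 0 < σX * σR := mul_pos hσX hσR
  have hpow : ((σX * σR) ^ 2) ^ ((3 : ℝ) / 2) = (σX * σR) ^ 3 := by
    rw [← Real.rpow_natCast, ← Real.rpow_mul hσ.le, ← Real.rpow_natCast]
    norm_num
  rw [C1, C2, C3, Real.mul_rpow (by positivity) (by positivity), hpow,
    mul_div_mul_left _ _ (by positivity)]
end

section
/- The kurtosis function γ₄(ρ) = 3(3 + 14ρ² + 3ρ⁴)/(1 + ρ²)² is an even function of ρ, is monotonically increasing on [0, 1], and satisfies 9 ≤ γ₄(ρ) ≤ 15 for all ρ ∈ [−1, 1], with minimum value 9 attained exactly at ρ = 0 and maximum value 15 attained exactly at ρ = ±1. -/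
/-- The kurtosis function as its minimum value plus a nonnegative term. -/
theorem kurtosis_eq_nine_add (ρ : ℝ) :
    3 * (3 + 14 * ρ ^ 2 + 3 * ρ ^ 4) / (1 + ρ ^ 2) ^ 2 =
      9 + 24 * (ρ ^ 2 / (1 + ρ ^ 2) ^ 2) := by
  field_simp
  ring

/-- The kurtosis function as its maximum value minus a nonnegative term. -/
theorem kurtosis_eq_fifteen_sub (ρ : ℝ) :
    3 * (3 + 14 * ρ ^ 2 + 3 * ρ ^ 4) / (1 + ρ ^ 2) ^ 2 =
      15 - 6 * ((1 - ρ ^ 2) / (1 + ρ ^ 2)) ^ 2 := by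
  field_simp
  ring

/-- The function `t ↦ t / (1 + t)²` is increasing on `[0, 1]`. -/
theorem monotoneOn_div_one_add_sq :
    MonotoneOn (fun t : ℝ => t / (1 + t) ^ 2) (Set.Icc 0 1) := by
  rintro s ⟨hs0, hs1⟩ t ⟨ht0, ht1⟩ hst
  have hst1 : s * t ≤ 1 := mul_le_one₀ hs1 ht0 ht1
  dsimp only
  rw [div_le_div_iff₀ (by positivity) (by positivity)]
  linarith [mul_nonneg (sub_nonneg.2 hst) (sub_nonneg.2 hst1)]

/-- The kurtosis function `γ₄(ρ) = 3(3 + 14ρ² + 3ρ⁴)/(1 + ρ²)²` of the one-period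
linear strategy is an even function of `ρ`, is monotonically increasing on `[0, 1]`,
and satisfies `9 ≤ γ₄(ρ) ≤ 15` on `[−1, 1]`, with minimum value `9` attained exactly
at `ρ = 0` and maximum value `15` attained exactly at `ρ = ±1`. -/
theorem kurtosis_function_properties :
    (∀ ρ : ℝ, 3 * (3 + 14 * (-ρ) ^ 2 + 3 * (-ρ) ^ 4) / (1 + (-ρ) ^ 2) ^ 2 =
      3 * (3 + 14 * ρ ^ 2 + 3 * ρ ^ 4) / (1 + ρ ^ 2) ^ 2) ∧
    MonotoneOn (fun ρ : ℝ => 3 * (3 + 14 * ρ ^ 2 + 3 * ρ ^ 4) / (1 + ρ ^ 2) ^ 2)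
      (Set.Icc 0 1) ∧
    (∀ ρ ∈ Set.Icc (-1 : ℝ) 1,
      (9 : ℝ) ≤ 3 * (3 + 14 * ρ ^ 2 + 3 * ρ ^ 4) / (1 + ρ ^ 2) ^ 2 ∧
      3 * (3 + 14 * ρ ^ 2 + 3 * ρ ^ 4) / (1 + ρ ^ 2) ^ 2 ≤ 15) ∧
    (∀ ρ ∈ Set.Icc (-1 : ℝ) 1,
      (3 * (3 + 14 * ρ ^ 2 + 3 * ρ ^ 4) / (1 + ρ ^ 2) ^ 2 = 9 ↔ ρ = 0) ∧
      (3 * (3 + 14 * ρ ^ 2 + 3 * ρ ^ 4) / (1 + ρ ^ 2) ^ 2 = 15 ↔ ρ = 1 ∨ ρ = -1)) := by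
  refine ⟨fun ρ => by simp only [even_two.neg_pow, (show Even 4 by decide).neg_pow], ?_, ?_, ?_⟩
  · rintro x ⟨hx0, hx1⟩ y ⟨hy0, hy1⟩ hxy
    have h : x ^ 2 / (1 + x ^ 2) ^ 2 ≤ y ^ 2 / (1 + y ^ 2) ^ 2 :=
      monotoneOn_div_one_add_sq ⟨sq_nonneg x, pow_le_one₀ hx0 hx1⟩
        ⟨sq_nonneg y, pow_le_one₀ hy0 hy1⟩ (pow_le_pow_left₀ hx0 hxy 2)
    simp only [kurtosis_eq_nine_add]
    linarith
  · intro ρ _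
    constructor
    · rw [kurtosis_eq_nine_add]
      have : 0 ≤ ρ ^ 2 / (1 + ρ ^ 2) ^ 2 := by positivity
      linarith
    · rw [kurtosis_eq_fifteen_sub]
      linarith [sq_nonneg ((1 - ρ ^ 2) / (1 + ρ ^ 2))]
  · intro ρ _
    have hρ : 1 + ρ ^ 2 ≠ 0 := by positivity
    constructor
    · rw [kurtosis_eq_nine_add]
      simp [hρ]
    · rw [kurtosis_eq_fifteen_sub]
      simp [hρ, sub_eq_zero, eq_comm (a := (1 : ℝ)) (b := ρ ^ 2)]
end

section
/- Fix N ≥ 1, μ ∈ ℝ^N, σ > 0, and an N×N real matrix M. Let ε and ε′ be independent random vectors in ℝ^N, each distributed as a centered Gaussian with covariance σ²·I (i.e., with independent N(0, σ²) coordinates). Set y = μ + ε, y′ = μ + ε′, and ŷ = My (the fitted values of a linear smoother with hat matrix M). Then the expected out-of-sample squared error exceeds the expected in-sample squared error by exactly twice the covariance penalty: E‖y′ − My‖² = E‖y − My‖² + 2σ²·Tr(M). -/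
open MeasureTheory ProbabilityTheory Matrix

/-- If `X` and `X'` have the same law and `X'` is uncorrelated with the predictor `A`, then the
mean squared errors of `A` for `X'` and for `X` differ by twice the covariance of `X` and `A`. -/
lemma integral_sub_sq_eq_add_two_mul_covariance {Ω : Type*} [MeasurableSpace Ω] {P : Measure Ω}
    [IsProbabilityMeasure P] {X X' A : Ω → ℝ} (hX : MemLp X 2 P) (hA : MemLp A 2 P)
    (hXX' : IdentDistrib X' X P P) (hX'A : cov[X', A; P] = 0) :
    ∫ ω, (X' ω - A ω) ^ 2 ∂P = ∫ ω, (X ω - A ω) ^ 2 ∂P + 2 * cov[X, A; P] := by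
  have hX' : MemLp X' 2 P := hXX'.symm.memLp_snd hX
  have sq_eq {Y : Ω → ℝ} (hY : MemLp Y 2 P) :
      ∫ ω, (Y ω - A ω) ^ 2 ∂P =
        Var[Y; P] - 2 * cov[Y, A; P] + Var[A; P] + (P[Y] - P[A]) ^ 2 := by
    have h := variance_eq_sub (hY.sub hA)
    rw [variance_sub hY hA, integral_sub' (hY.integrable one_le_two)
      (hA.integrable one_le_two)] at h
    simp only [Pi.pow_apply, Pi.sub_apply] at h
    linarith
  rw [sq_eq hX', sq_eq hX, hXX'.variance_eq, hXX'.integral_eq, hX'A]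
  ring

/-- The coordinates under a product of probability measures are uncorrelated. -/
lemma covariance_eval_pi {ι : Type*} [Fintype ι] [DecidableEq ι] {ν : ι → Measure ℝ}
    [∀ i, IsProbabilityMeasure (ν i)] (hν : ∀ i, MemLp id 2 (ν i)) (i j : ι) :
    cov[fun x ↦ x i, fun x ↦ x j; Measure.pi ν] = if i = j then Var[id; ν i] else 0 := by
  have hmem (k : ι) : MemLp (fun x : ι → ℝ ↦ x k) 2 (Measure.pi ν) :=
    (hν k).comp_measurePreserving (measurePreserving_eval ν k)
  split_ifs with hij
  · subst hij
    rw [covariance_self (hmem i).aemeasurable, ← (measurePreserving_eval ν i).map_eq,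
      variance_map aemeasurable_id (measurable_pi_apply i).aemeasurable]
    rfl
  · exact ((iIndepFun_pi (X := fun _ ↦ id) fun k ↦ aemeasurable_id).indepFun
      hij).covariance_eq_zero (hmem i) (hmem j)

/-- **Covariance-penalty (optimism) identity behind Mallows' Cp.**  Let `y = μ + ε`
and `y′ = μ + ε′`, where `ε` and `ε′` are independent centered Gaussian noise vectors
in `ℝ^N` with independent `N(0, σ²)` coordinates (the pair `(ε, ε′)` being modelled by
the product of the two `N`-fold product Gaussian measures), and let `ŷ = My` be the
fitted values of a linear smoother with hat matrix `M`.  Then the expected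
out-of-sample squared error exceeds the expected in-sample squared error by exactly
twice the covariance penalty:
`E‖y′ − My‖² = E‖y − My‖² + 2σ²·Tr(M)`. -/
theorem covariance_penalty_identity (N : ℕ) (hN : 1 ≤ N) (μ : Fin N → ℝ) (σ : ℝ)
    (hσ : 0 < σ) (M : Matrix (Fin N) (Fin N) ℝ) :
    (∫ w : (Fin N → ℝ) × (Fin N → ℝ),
        ∑ i, ((μ + w.2) i - M.mulVec (μ + w.1) i) ^ 2
        ∂((Measure.pi fun _ : Fin N => gaussianReal 0 (Real.toNNReal (σ ^ 2))).prod
          (Measure.pi fun _ : Fin N => gaussianReal 0 (Real.toNNReal (σ ^ 2))))) =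
    (∫ w : (Fin N → ℝ) × (Fin N → ℝ),
        ∑ i, ((μ + w.1) i - M.mulVec (μ + w.1) i) ^ 2
        ∂((Measure.pi fun _ : Fin N => gaussianReal 0 (Real.toNNReal (σ ^ 2))).prod
          (Measure.pi fun _ : Fin N => gaussianReal 0 (Real.toNNReal (σ ^ 2))))) +
      2 * σ ^ 2 * M.trace := by
  set γ := gaussianReal 0 (Real.toNNReal (σ ^ 2)) with hγ
  set π := Measure.pi fun _ : Fin N => γ
  have hid : MemLp id 2 γ := memLp_id_gaussianReal 2
  have hfst (i : Fin N) : MeasurePreserving (fun w : (Fin N → ℝ) × (Fin N → ℝ) ↦ w.1 i)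
      (π.prod π) γ := (measurePreserving_eval (fun _ ↦ γ) i).comp measurePreserving_fst
  have hsnd (i : Fin N) : MeasurePreserving (fun w : (Fin N → ℝ) × (Fin N → ℝ) ↦ w.2 i)
      (π.prod π) γ := (measurePreserving_eval (fun _ ↦ γ) i).comp measurePreserving_snd
  have hnoise (i : Fin N) : MemLp (fun w : (Fin N → ℝ) × (Fin N → ℝ) ↦ w.1 i) 2 (π.prod π) :=
    hid.comp_measurePreserving (hfst i)
  have hy (i : Fin N) : MemLp (fun w : (Fin N → ℝ) × (Fin N → ℝ) ↦ (μ + w.1) i) 2 (π.prod π) :=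
    (memLp_const (μ i)).add (hnoise i)
  have hy' (i : Fin N) : MemLp (fun w : (Fin N → ℝ) × (Fin N → ℝ) ↦ (μ + w.2) i) 2 (π.prod π) :=
    (memLp_const (μ i)).add (hid.comp_measurePreserving (hsnd i))
  have hfit (i : Fin N) : MemLp (fun w : (Fin N → ℝ) × (Fin N → ℝ) ↦ M.mulVec (μ + w.1) i) 2
      (π.prod π) := by
    simp only [mulVec, dotProduct]
    exact memLp_finsetSum _ fun j _ ↦ (hy j).const_mul (M i j)
  have hident (i : Fin N) : IdentDistrib (fun w : (Fin N → ℝ) × (Fin N → ℝ) ↦ (μ + w.2) i)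
      (fun w ↦ (μ + w.1) i) (π.prod π) (π.prod π) :=
    IdentDistrib.comp (u := fun x ↦ μ i + x) ⟨(hsnd i).measurable.aemeasurable,
      (hfst i).measurable.aemeasurable, (hsnd i).map_eq.trans (hfst i).map_eq.symm⟩ (by fun_prop)
  have hindep (i : Fin N) : cov[fun w : (Fin N → ℝ) × (Fin N → ℝ) ↦ (μ + w.2) i,
      fun w ↦ M.mulVec (μ + w.1) i; π.prod π] = 0 := by
    refine IndepFun.covariance_eq_zero ?_ (hy' i) (hfit i)
    refine (indepFun_prod (μ := π) (ν := π) (X := fun x ↦ M.mulVec (μ + x) i)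
      (Y := fun x ↦ (μ + x) i) ?_ ?_).symm
    · simp only [mulVec, dotProduct, Pi.add_apply]
      fun_prop
    · simp only [Pi.add_apply]
      fun_prop
  have hcov_noise (i j : Fin N) : cov[fun w : (Fin N → ℝ) × (Fin N → ℝ) ↦ (μ + w.1) i,
      fun w ↦ (μ + w.1) j; π.prod π] = if i = j then σ ^ 2 else 0 := by
    simp only [Pi.add_apply]
    rw [covariance_const_add_left ((hnoise i).integrable one_le_two),
      covariance_const_add_right ((hnoise j).integrable one_le_two),
      ← covariance_map_fun (X := fun x : Fin N → ℝ ↦ x i) (Y := fun x ↦ x j)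
        (measurable_pi_apply i).aestronglyMeasurable (measurable_pi_apply j).aestronglyMeasurable
        measurable_fst.aemeasurable,
      measurePreserving_fst.map_eq, covariance_eval_pi fun _ ↦ hid, hγ, variance_id_gaussianReal,
      Real.coe_toNNReal _ (sq_nonneg σ)]
  have hcov_fit (i : Fin N) : cov[fun w : (Fin N → ℝ) × (Fin N → ℝ) ↦ (μ + w.1) i,
      fun w ↦ M.mulVec (μ + w.1) i; π.prod π] = σ ^ 2 * M i i := by
    simp only [mulVec, dotProduct]
    rw [covariance_fun_sum_right (fun j ↦ (hy j).const_mul (M i j)) (hy i)]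
    simp [-Pi.add_apply, covariance_const_mul_right, hcov_noise, mul_comm]
  rw [integral_finsetSum _ (by exact fun i _ ↦ ((hy' i).sub (hfit i)).integrable_sq),
    integral_finsetSum _ (by exact fun i _ ↦ ((hy i).sub (hfit i)).integrable_sq), Matrix.trace,
    Finset.mul_sum, ← Finset.sum_add_distrib]
  refine Finset.sum_congr rfl fun i _ ↦ ?_
  rw [integral_sub_sq_eq_add_two_mul_covariance (hy i) (hfit i) (hident i) (hindep i),
    hcov_fit, Matrix.diag_apply, mul_assoc]
end
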